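/- Fix an integer r ≥ 2 and n ≥ 5. For every subset V of [1, c_{n−1}], |f(V)| = r·|V| − |f*(V)| − δ_V. -/

import Mathlib

open scoped Classical

namespace CF

noncomputable section

/-- The sequence `c` : `c 1 = 0`, `c 2 = 1`, `c n = r * c (n-1) - c (n-2)`.
(The value `c 0 = -1` is the unique value consistent with the recurrence.) -/
def c (r : ℕ) : ℕ → ℤ
  | 0 => -1
  | 1 => 0
  | n + 2 => (r : ℤ) * c r (n + 1) - c r n

/-- `c` as a natural number (valid for indices `≥ 1` when `r ≥ 2`). -/
def cN (r n : ℕ) : ℕ := (c r n).toNat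

/-- Height (y-coordinate) of the vertex `w_k` of the maximal Dyck path `D_n`:
the maximal Dyck path from `(0,0)` to `(c_{n-1}-c_{n-2}, c_{n-2})` weakly below the
diagonal has `w_k = (k - ⌊k·c_{n-2}/c_{n-1}⌋, ⌊k·c_{n-2}/c_{n-1}⌋)`. -/
def hgt (r n k : ℕ) : ℕ := k * cN r (n - 2) / cN r (n - 1)

/-- The edge `α_j` of `D_n` is vertical (a north step). -/
def isVert (r n j : ℕ) : Prop := hgt r n (j - 1) < hgt r n j

/-- Index in the vertex sequence `w_0, …, w_{c_{n-1}}` of the vertex `v_j`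
(the upper endpoint of the `j`-th vertical edge); `vpos r n 0 = 0`. -/
def vpos (r n j : ℕ) : ℕ := (j * cN r (n - 1) + cN r (n - 2) - 1) / cN r (n - 2)

/-- x-coordinate of the vertex `v_j` of `D_n` (its y-coordinate is `j`). -/
def vx (r n j : ℕ) : ℤ := (vpos r n j : ℤ) - (j : ℤ)

/-- The slope `s_{i,t}` between `v_i` and `v_t` is at most the slope `s` of the diagonal,
expressed by cross-multiplication. -/
def slopeLE (r n i t : ℕ) : Prop :=
  ((t : ℤ) - (i : ℤ)) * (c r (n - 1) - c r (n - 2)) ≤ (vx r n t - vx r n i) * c r (n - 2)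

/-- `{t | i < t ≤ k, s_{i,t} > s}`. -/
def badSet (r n i k : ℕ) : Finset ℕ :=
  (Finset.Icc (i + 1) k).filter fun t => ¬ slopeLE r n i t

/-- `α(i,k)` is blue: `s_{i,t} ≤ s` for all `i < t ≤ k`. -/
def isBlue (r n i k : ℕ) : Prop := badSet r n i k = ∅

/-- `t₀` is the minimum of `{t | i < t ≤ k, s_{i,t} > s}`. -/
def minBad (r n i k t₀ : ℕ) : Prop :=
  t₀ ∈ badSet r n i k ∧ ∀ t ∈ badSet r n i k, t₀ ≤ t

/-- `α(i,k)` is `(m,w)`-green: the minimum `t₀` of `{t | i < t ≤ k, s_{i,t} > s}` exists and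
equals `i + c_m - w·c_{m-1}`, with `3 ≤ m ≤ n-2` and `1 ≤ w < r-1`. -/
def isGreenMW (r n i k m w : ℕ) : Prop :=
  3 ≤ m ∧ m + 2 ≤ n ∧ 1 ≤ w ∧ (w : ℤ) < (r : ℤ) - 1 ∧
    ∃ t₀ : ℕ, minBad r n i k t₀ ∧ (t₀ : ℤ) = (i : ℤ) + (c r m - (w : ℤ) * c r (m - 1))

def isGreen (r n i k : ℕ) : Prop := ∃ m w, isGreenMW r n i k m w

/-- `α(i,k)` is red: neither blue nor green. -/
def isRed (r n i k : ℕ) : Prop := ¬ isBlue r n i k ∧ ¬ isGreen r n i k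

/-- An element of `P(D_n)`: either a single edge `α_j` (`Sum.inl j`) or a subpath
`α(i,k)` (`Sum.inr (i,k)`). -/
abbrev Elt := ℕ ⊕ ℕ × ℕ

/-- The set of (indices of) edges of `D_n` constituting an element of `P(D_n)`:
a single edge; for `α(i,k)`, the edges from `v_i` (or from its immediate predecessor,
in the red case) to `v_k`. -/
def edges (r n : ℕ) : Elt → Finset ℕ
  | Sum.inl j => {j}
  | Sum.inr (i, k) =>
      if isRed r n i k then Finset.Icc (vpos r n i) (vpos r n k)
      else Finset.Icc (vpos r n i + 1) (vpos r n k)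

/-- Validity of an element of `P(D_n)`: `1 ≤ j ≤ c_{n-1}` for a single edge,
`0 ≤ i < k ≤ c_{n-2}` for a subpath `α(i,k)`. -/
def validElt (r n : ℕ) : Elt → Prop
  | Sum.inl j => 1 ≤ j ∧ (j : ℤ) ≤ c r (n - 1)
  | Sum.inr (i, k) => i < k ∧ (k : ℤ) ≤ c r (n - 2)

/-- The common conditions on a collection `β = {β_1,…,β_t}` of elements of `P(D_n)`:
all elements are valid, distinct elements share no edge, and for any two subpaths
`α(i,k)`, `α(i',k')` one has `i ≠ k'` and `i' ≠ k`. -/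
def validColl (r n : ℕ) (β : Finset Elt) : Prop :=
  (∀ p ∈ β, validElt r n p) ∧
  (∀ p ∈ β, ∀ q ∈ β, p ≠ q → Disjoint (edges r n p) (edges r n q)) ∧
  (∀ i k i' k' : ℕ, Sum.inr (i, k) ∈ β → Sum.inr (i', k') ∈ β → i ≠ k' ∧ i' ≠ k)

/-- The `c_{m-1} - w·c_{m-2}` edges of `D_n` immediately preceding the vertex `v_i`. -/
def precEdges (r n i m w : ℕ) : Finset ℕ :=
  Finset.Icc (vpos r n i + 1 - (c r (m - 1) - (w : ℤ) * c r (m - 2)).toNat) (vpos r n i)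

/-- The set `F(D_n)`. -/
def FD (r n : ℕ) : Set (Finset Elt) :=
  {β | validColl r n β ∧
    ∀ i k m w : ℕ, Sum.inr (i, k) ∈ β → isGreenMW r n i k m w →
      ∃ e ∈ precEdges r n i m w, ∃ p ∈ β, e ∈ edges r n p}

/-- The set `F̃(D_n)`. -/
def Ftilde (r n : ℕ) : Set (Finset Elt) := {β | validColl r n β}

/-- The set `T^{≥u}(D_n)`. -/
def Tge (r n u : ℕ) : Set (Finset Elt) :=
  {β | validColl r n β ∧ β.Nonempty ∧
    ∃ i k m w : ℕ, u ≤ m ∧ Sum.inr (i, k) ∈ β ∧ isGreenMW r n i k m w ∧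
      ∀ e ∈ precEdges r n i m w, ∀ p ∈ β, e ∉ edges r n p}

/-- `|β_j|_1` for a single element. -/
def wt1 : Elt → ℕ
  | Sum.inl _ => 0
  | Sum.inr (i, k) => k - i

/-- `|β|_1`. -/
def B1 (β : Finset Elt) : ℕ := ∑ p ∈ β, wt1 p

/-- `|β|_2`: the total number of edges in the collection `β`. -/
def B2 (r n : ℕ) (β : Finset Elt) : ℕ := (β.biUnion (edges r n)).card

/-- The field `ℚ(x₁,x₂)`. -/
abbrev K := FractionRing (MvPolynomial (Fin 2) ℚ)

/-- The indeterminate `x₁`. -/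
def x₁ : K := algebraMap (MvPolynomial (Fin 2) ℚ) K (MvPolynomial.X 0)

/-- The indeterminate `x₂`. -/
def x₂ : K := algebraMap (MvPolynomial (Fin 2) ℚ) K (MvPolynomial.X 1)

/-- `b_{n-1,k}`: `r` if the edge `α_k` of `D_n` is horizontal, `r-1` if vertical. -/
def bseq (r n k : ℕ) : ℕ := if isVert r n k then r - 1 else r

/-- Prefix sums `S e = Σ_{k=1}^{e} b_{n-1,k}`. -/
def S (r n e : ℕ) : ℕ := ∑ k ∈ Finset.Icc 1 e, bseq r n k

/-- The interval `[a,b] ⊆ [1,c_n]` is (the edge set of) a blue or green subpath of `D_{n+1}`. -/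
def isBGinterval (r n a b : ℕ) : Prop :=
  ∃ i k : ℕ, i < k ∧ (k : ℤ) ≤ c r (n - 1) ∧ ¬ isRed r (n + 1) i k ∧
    Finset.Icc a b = Finset.Icc (vpos r (n + 1) i + 1) (vpos r (n + 1) k)

/-- Left endpoints of the maximal interval components of `V`. -/
def starts (V : Finset ℕ) : Finset ℕ := V.filter fun e => e - 1 ∉ V

/-- Right endpoint of the maximal interval component of `V` starting at `e`. -/
def compEnd (V : Finset ℕ) (e : ℕ) : ℕ := sSup {g : ℕ | Finset.Icc e g ⊆ V}

/-- `f_i(V)`: the image of the maximal interval component of `V` starting at `e`. -/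
def fcomp (r n : ℕ) (V : Finset ℕ) (e : ℕ) : Finset ℕ :=
  if isBGinterval r n (S r n (e - 1) + 1) (S r n (compEnd V e)) then
    Finset.Icc (S r n (e - 1) + 1) (S r n (compEnd V e))
  else
    insert (S r n (e - 1)) (Finset.Icc (S r n (e - 1) + 1) (S r n (compEnd V e)))

/-- The map `f` from subsets of `[1,c_{n-1}]` to subsets of `[1,c_n]`. -/
def fmap (r n : ℕ) (V : Finset ℕ) : Finset ℕ := (starts V).biUnion (fcomp r n V)

/-- The pull-back `f*` (of the map `f` one level down, from subsets of `[1,c_{n-2}]`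
to subsets of `[1,c_{n-1}]`). -/
def fstar (r n : ℕ) (W : Finset ℕ) : Finset ℕ :=
  ((Finset.Icc 1 (cN r (n - 2))).powerset.filter fun U => fmap r (n - 1) U ⊆ W).biUnion id

/-- `δ` of a maximal interval component `[e,g]`: `1` if the `w`-th edge of the corresponding
subpath of `D_n` is vertical for some `2 ≤ w ≤ r-1`, and `0` otherwise. -/
def deltaComp (r n e g : ℕ) : ℕ :=
  if ∃ w : ℕ, 2 ≤ w ∧ w ≤ r - 1 ∧ e + w - 1 ≤ g ∧ isVert r n (e + w - 1) then 1 else 0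

/-- `δ_V`. -/
def deltaV (r n : ℕ) (V : Finset ℕ) : ℕ :=
  ∑ e ∈ starts V, deltaComp r n e (compEnd V e)

/-- Generalized binomial coefficient for integers `A`, `B`. -/
def gbinom (A B : ℤ) : ℚ :=
  if B < 0 then 0
  else (∏ i ∈ Finset.range B.toNat, ((A : ℚ) - (i : ℚ))) / (B.toNat.factorial : ℚ)

/-- `z_n` for `n ≥ 4`, given by the sum over `F̃(D_n)`. -/
def zF (r n : ℕ) : K :=
  x₁ ^ (-(c r (n - 1))) * x₂ ^ (-(c r (n - 2))) *
    ∑ᶠ β ∈ Ftilde r n,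
      x₁ ^ ((r : ℤ) * (B1 β : ℤ)) * x₂ ^ ((r : ℤ) * (c r (n - 1) - (B2 r n β : ℤ)))

/-- `z_n`, with `z_3 = x_3` (the value `x3` is the cluster variable `x_3`). -/
def z (r : ℕ) (x3 : K) (n : ℕ) : K := if n = 3 then x3 else zF r n

end

theorem c_rec (r n : ℕ) : c r (n + 2) = (r : ℤ) * c r (n + 1) - c r n := rfl

theorem c_mono_aux (r : ℕ) (hr : 2 ≤ r) (n : ℕ) : c r n < c r (n + 1) ∧ 0 ≤ c r (n + 1) := by
  induction n with
  | zero => simp [c]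
  | succ k ih =>
    obtain ⟨h1, h2⟩ := ih
    have hr' : (2 : ℤ) ≤ r := by exact_mod_cast hr
    rw [c_rec]
    constructor <;> nlinarith

theorem c_lt (r : ℕ) (hr : 2 ≤ r) (n : ℕ) : c r n < c r (n + 1) := (c_mono_aux r hr n).1

theorem c_pos (r : ℕ) (hr : 2 ≤ r) (n : ℕ) : 1 ≤ c r (n + 2) := by
  have := c_lt r hr (n + 1)
  have := (c_mono_aux r hr n).2
  have e : n + 1 + 1 = n + 2 := rfl
  rw [e] at *
  omega

theorem c_mixed (r m k : ℕ) :
    c r m * c r (m + k + 1) - c r (m + 1) * c r (m + k) = - c r (k + 1) := by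
  induction m with
  | zero => simp [c]
  | succ m ih =>
    have e1 : c r (m + 1 + k + 1) = r * c r (m + k + 1) - c r (m + k) := by
      rw [show m + 1 + k + 1 = (m + k) + 2 by ring]; rfl
    have e2 : c r (m + 1 + k) = c r (m + k + 1) := by congr 1; ring
    rw [e1, e2, c_rec, ← ih]; ring

theorem c_det (r m : ℕ) : c r (m + 1) * c r (m + 1) - c r (m + 2) * c r m = 1 := by
  induction m with
  | zero => simp [c]
  | succ m ih =>
    have h1 := c_rec r m
    have h2 := c_rec r (m + 1)
    rw [show m + 1 + 1 = m + 2 from rfl] at *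
    rw [h2]
    linear_combination ih + (c r (m + 2)) * h1

theorem cN_cast (r : ℕ) (hr : 2 ≤ r) (n : ℕ) : (cN r (n + 1) : ℤ) = c r (n + 1) := by
  unfold cN
  exact Int.toNat_of_nonneg (c_mono_aux r hr n).2

/-- lattice lemma -/
theorem lattice (N A P p' Q q' d q : ℤ) (hP : 0 < P) (hQ : 0 < Q)
    (hdet : P * q' - p' * Q = -1) (hL2 : 0 < Q * A - q' * N)
    (hd : 0 < d) (h1 : 0 < q * N - d * A) (h2 : q * N - d * A < p' * N - P * A) :
    P + Q ≤ d := by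
  obtain ⟨a, ha⟩ : ∃ a, a = q * Q - d * q' := ⟨_, rfl⟩
  obtain ⟨b, hb⟩ : ∃ b, b = p' * d - P * q := ⟨_, rfl⟩
  have ed : d = a * P + b * Q := by
    rw [ha, hb]; linear_combination d * hdet
  have eL : q * N - d * A = a * (p' * N - P * A) - b * (Q * A - q' * N) := by
    rw [ha, hb]; linear_combination (q * N - d * A) * hdet
  have hL1 : 0 < p' * N - P * A := h1.trans h2
  generalize q * N - d * A = L at *
  generalize p' * N - P * A = L1 at *
  generalize Q * A - q' * N = L2 at *
  rcases le_or_gt a 0 with h | h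
  · exfalso
    have : b < 0 := by
      by_contra hb0
      push Not at hb0
      nlinarith [mul_nonneg hb0 hL2.le]
    nlinarith
  · have : 0 < b := by
      by_contra hb0
      push Not at hb0
      nlinarith [mul_nonneg (neg_nonneg.mpr hb0) hL2.le]
    nlinarith

theorem find_k (r n : ℕ) (x : ℤ) (hx : 1 ≤ x)
    (hx2 : x < c r (n + 3) - c r (n + 2)) :
    ∃ k : ℕ, k ≤ n ∧ c r (k + 2) - c r (k + 1) ≤ x ∧ x < c r (k + 3) - c r (k + 2) := by
  induction n with
  | zero => exact ⟨0, le_rfl, by simpa [c] using hx, hx2⟩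
  | succ n ih =>
    by_cases h : c r (n + 1 + 2) - c r (n + 1 + 1) ≤ x
    · exact ⟨n + 1, le_rfl, h, hx2⟩
    · obtain ⟨k, hk, h'⟩ := ih (not_le.mp h)
      exact ⟨k, by omega, h'⟩

theorem find_mw (r : ℕ) (hr : 2 ≤ r) (n : ℕ) (x : ℤ) (hx : 1 ≤ x)
    (hx2 : x < c r (n + 3) - c r (n + 2)) :
    ∃ w k : ℕ, k ≤ n ∧ 1 ≤ w ∧ w + 2 ≤ r ∧
      (w : ℤ) * c r (k + 2) - c r (k + 1) ≤ x ∧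
      x < ((w : ℤ) + 1) * c r (k + 2) - c r (k + 1) := by
  obtain ⟨k, hk, h1, h2⟩ := find_k r n x hx hx2
  have h3 := c_rec r (k + 1)
  have hex : ∃ w : ℕ, x < ((w : ℤ) + 1) * c r (k + 2) - c r (k + 1) := by
    refine ⟨r - 2, ?_⟩
    push_cast [hr]
    have : c r (k + 3) = (r : ℤ) * c r (k + 2) - c r (k + 1) := h3
    linarith
  have hle : Nat.find hex ≤ r - 2 := by
    apply Nat.find_min'
    push_cast [hr]
    have : c r (k + 3) = (r : ℤ) * c r (k + 2) - c r (k + 1) := h3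
    linarith
  have hs := Nat.find_spec hex
  have hm := fun m => Nat.find_min hex (m := m)
  generalize Nat.find hex = w at *
  rcases w with _ | w
  · simp at hs; omega
  · refine ⟨w + 1, k, hk, by omega, by omega, ?_, hs⟩
    have := hm w (by omega)
    push_cast
    linarith

theorem S_step_aux (A N i : ℕ) (hN : 0 < N) (hAN : A ≤ N) :
    (i + 1) * A / N ≤ i * A / N + 1 := by
  calc (i + 1) * A / N ≤ (i * A + N) / N := Nat.div_le_div_right (by linarith [add_one_mul i A])
    _ = _ := Nat.add_div_right _ hN

structure Lev (r n A N B : ℕ) : Prop where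
  hA : cN r (n - 2) = A
  hN : cN r (n - 1) = N
  hB : cN r n = B
  cA : c r (n - 2) = A
  cN' : c r (n - 1) = N
  cB : c r n = B
  pA : 0 < A
  AN : A < N
  rel : B + A = r * N
  NB : N < B

theorem lev (r : ℕ) (hr : 2 ≤ r) (n : ℕ) (hn : 4 ≤ n) :
    Lev r n (cN r (n - 2)) (cN r (n - 1)) (cN r n) := by
  obtain ⟨k, rfl⟩ : ∃ k, n = k + 4 := ⟨n - 4, by omega⟩
  simp only [show k + 4 - 2 = k + 2 by omega, show k + 4 - 1 = k + 3 by omega]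
  have e1 := cN_cast r hr (k + 1)
  have e2 := cN_cast r hr (k + 2)
  have e3 := cN_cast r hr (k + 3)
  have l1 := c_lt r hr (k + 2)
  have l2 := c_lt r hr (k + 3)
  have p := c_pos r hr k
  have rc := c_rec r (k + 2)
  simp only [add_assoc] at *
  norm_num at *
  refine ⟨rfl, rfl, rfl, e1.symm, e2.symm, e3.symm, ?_, ?_, ?_, ?_⟩
  · omega
  · omega
  · zify; rw [e1, e2, e3, rc]; ring
  · omega

theorem hgt_spec (r n : ℕ) {A N B : ℕ} (L : Lev r n A N B) (k : ℕ) :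
    hgt r n k * N ≤ k * A ∧ k * A < (hgt r n k + 1) * N := by
  have hN : 0 < N := L.pA.trans L.AN
  unfold hgt
  rw [L.hA, L.hN]
  exact ⟨Nat.div_mul_le_self _ _, by
    have := Nat.lt_div_mul_add (a := k * A) hN
    rw [add_one_mul]; exact this⟩

theorem hgt_succ (r n : ℕ) {A N B : ℕ} (L : Lev r n A N B) (k : ℕ) :
    hgt r n k ≤ hgt r n (k + 1) ∧ hgt r n (k + 1) ≤ hgt r n k + 1 := by
  have hN : 0 < N := L.pA.trans L.AN
  unfold hgt
  rw [L.hA, L.hN]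
  exact ⟨Nat.div_le_div_right (by nlinarith), S_step_aux _ _ _ hN L.AN.le⟩

theorem hgt_le (r n : ℕ) {A N B : ℕ} (L : Lev r n A N B) (k : ℕ) : hgt r n k ≤ k := by
  have h := (hgt_spec r n L k).1
  have hN : 0 < N := L.pA.trans L.AN
  have := L.AN
  by_contra hc
  push Not at hc
  nlinarith

theorem bseq_eq (r n : ℕ) (hr : 2 ≤ r) {A N B : ℕ} (L : Lev r n A N B) (k : ℕ) :
    bseq r n (k + 1) + hgt r n (k + 1) = r + hgt r n k := by
  have := hgt_succ r n L k
  unfold bseq isVert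
  simp only [Nat.add_sub_cancel]
  split_ifs <;> omega

theorem S_succ (r n k : ℕ) : S r n (k + 1) = S r n k + bseq r n (k + 1) := by
  unfold S
  rw [Finset.sum_Icc_succ_top (by omega)]

theorem S_zero (r n : ℕ) : S r n 0 = 0 := by simp [S]

theorem hgt_zero (r n : ℕ) : hgt r n 0 = 0 := by simp [hgt]

theorem S_hgt (r n : ℕ) (hr : 2 ≤ r) {A N B : ℕ} (L : Lev r n A N B) (k : ℕ) :
    S r n k + hgt r n k = r * k := by
  induction k with
  | zero => simp [S_zero, hgt_zero]
  | succ k ih =>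
    have := bseq_eq r n hr L k
    rw [S_succ, mul_add]
    omega

theorem vpos_hgt (r n : ℕ) (hr : 2 ≤ r) {A N B : ℕ} (L : Lev r n A N B) (k : ℕ) :
    vpos r (n + 1) k + hgt r n k = r * k := by
  have hN : 0 < N := L.pA.trans L.AN
  obtain ⟨h1, h2⟩ := hgt_spec r n L k
  have hl := hgt_le r n L k
  have hS := S_hgt r n hr L k
  suffices vpos r (n + 1) k = S r n k by rw [this, hS]
  unfold vpos
  simp only [show n + 1 - 1 = n by omega, show n + 1 - 2 = n - 1 by omega, L.hN, L.hB]
  have hrel := L.rel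
  generalize S r n k = s at *
  generalize hgt r n k = h at *
  have key : k * B + k * A = s * N + h * N := by
    rw [← mul_add, hrel, ← add_mul, hS]; ring
  rw [add_mul] at h2
  have e : k * B + N - 1 = (N - 1 - (k * A - h * N)) + s * N := by omega
  rw [e, Nat.add_mul_div_right _ _ hN, Nat.div_eq_of_lt (by omega)]
  simp

theorem S_eq_vpos (r n : ℕ) (hr : 2 ≤ r) {A N B : ℕ} (L : Lev r n A N B) (k : ℕ) :
    vpos r (n + 1) k = S r n k := by
  have := vpos_hgt r n hr L k
  have := S_hgt r n hr L k
  omega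

theorem bseq_pos (r n : ℕ) (hr : 2 ≤ r) (k : ℕ) : r - 1 ≤ bseq r n k := by
  unfold bseq; split_ifs <;> omega

theorem S_strictMono (r n : ℕ) (hr : 2 ≤ r) : StrictMono (S r n) := by
  apply strictMono_nat_of_lt_succ
  intro k
  rw [S_succ]
  have := bseq_pos r n hr (k + 1)
  omega

theorem slopeLE_iff (r n : ℕ) (hr : 2 ≤ r) {A N B : ℕ} (L : Lev r n A N B) (i t : ℕ) :
    slopeLE r (n + 1) i t ↔
      ((hgt r n t : ℤ) - hgt r n i) * N ≤ ((t : ℤ) - i) * A := by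
  have h1 := vpos_hgt r n hr L i
  have h2 := vpos_hgt r n hr L t
  unfold slopeLE vx
  simp only [show n + 1 - 1 = n by omega, show n + 1 - 2 = n - 1 by omega, L.cN', L.cB]
  have hrel := L.rel
  zify at h1 h2 hrel
  have e1 : (vpos r (n + 1) i : ℤ) = r * i - hgt r n i := by linarith
  have e2 : (vpos r (n + 1) t : ℤ) = r * t - hgt r n t := by linarith
  have e3 : (B : ℤ) = r * N - A := by linarith
  rw [e1, e2, e3]
  constructor <;> intro h <;> nlinarith

theorem red_of_vert (r n : ℕ) (hr : 2 ≤ r) {A N B : ℕ} (L : Lev r n A N B) (i k : ℕ)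
    (hik : i < k) (hv : isVert r n (i + 1)) : isRed r (n + 1) i k := by
  have hs := hgt_succ r n L i
  have hAN := L.AN
  have hv' : hgt r n (i + 1) = hgt r n i + 1 := by
    unfold isVert at hv
    simp only [Nat.add_sub_cancel] at hv
    omega
  have hmem : i + 1 ∈ badSet r (n + 1) i k := by
    unfold badSet
    rw [Finset.mem_filter, Finset.mem_Icc, slopeLE_iff r n hr L, hv']
    refine ⟨by omega, ?_⟩
    push_cast
    push Not
    ring_nf
    exact_mod_cast hAN
  refine ⟨?_, ?_⟩
  · intro h
    unfold isBlue at h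
    rw [h] at hmem
    simp at hmem
  · rintro ⟨m, w, hm, hmn, hw1, hw2, t0, ⟨ht0, hmin⟩, ht⟩
    have h1 := hmin _ hmem
    unfold badSet at ht0
    rw [Finset.mem_filter, Finset.mem_Icc] at ht0
    have : t0 = i + 1 := by omega
    rw [this] at ht
    push_cast at ht
    obtain ⟨j, rfl⟩ : ∃ j, m = j + 3 := ⟨m - 3, by omega⟩
    simp only [show j + 3 - 1 = j + 2 by omega] at ht
    have hrec : c r (j + 3) = r * c r (j + 2) - c r (j + 1) := c_rec r (j + 1)
    have hp := c_pos r hr j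
    have hlt : c r (j + 1) < c r (j + 2) := c_lt r hr (j + 1)
    rw [hrec] at ht
    nlinarith [mul_nonneg (show (0 : ℤ) ≤ r - 2 - w by omega) (show 0 ≤ c r (j + 2) by omega)]

set_option maxHeartbeats 2000000 in
theorem not_red_of_not_vert (r n : ℕ) (hr : 2 ≤ r) (hn : 4 ≤ n) {A N B : ℕ}
    (L : Lev r n A N B) (i k : ℕ)
    (hv : ¬ isVert r n (i + 1)) : ¬ isRed r (n + 1) i k := by
  have hs := hgt_succ r n L i
  have hAN := L.AN
  have hN : 0 < N := L.pA.trans L.AN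
  have hv' : hgt r n (i + 1) = hgt r n i := by
    unfold isVert at hv
    simp only [Nat.add_sub_cancel] at hv
    omega
  obtain ⟨hi1, hi2⟩ := hgt_spec r n L i
  obtain ⟨hj1, hj2⟩ := hgt_spec r n L (i + 1)
  rw [hv'] at hj2
  obtain ⟨x, hx⟩ : ∃ x : ℤ, x = (i : ℤ) * A - hgt r n i * N := ⟨_, rfl⟩
  zify at hi1 hi2 hj2
  rintro ⟨hb, hg⟩
  have hne : (badSet r (n + 1) i k).Nonempty := Finset.nonempty_iff_ne_empty.mpr hb
  obtain ⟨t0, ht0, hmin⟩ : ∃ t0, t0 ∈ badSet r (n + 1) i k ∧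
      ∀ t ∈ badSet r (n + 1) i k, t0 ≤ t :=
    ⟨_, Finset.min'_mem _ hne, fun t ht => Finset.min'_le _ t ht⟩
  have hmem : ∀ t, t ∈ badSet r (n + 1) i k ↔ (i < t ∧ t ≤ k) ∧
      ((t : ℤ) - i) * A < ((hgt r n t : ℤ) - hgt r n i) * N := by
    intro t
    unfold badSet
    rw [Finset.mem_filter, Finset.mem_Icc, slopeLE_iff r n hr L, not_le]
    rfl
  obtain ⟨⟨hit, htk⟩, hbad⟩ := (hmem t0).1 ht0
  have hts := (hgt_spec r n L t0).1
  zify at hts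
  have hx1 : 1 ≤ x := by
    have : (0 : ℤ) < x := by nlinarith
    omega
  have cA := L.cA
  have cN' := L.cN'
  obtain ⟨l, rfl⟩ : ∃ l, n = l + 4 := ⟨n - 4, by omega⟩
  simp only [show l + 4 - 2 = l + 2 by omega, show l + 4 - 1 = l + 3 by omega] at cA cN'
  obtain ⟨w, q, hq, hw1, hw2, hx3, hx4⟩ := find_mw r hr l x hx1 (by
    rw [cA, cN', hx]; push_cast at hj2; linarith)
  obtain ⟨j, rfl⟩ : ∃ j, l = j + q := ⟨l - q, by omega⟩
  -- m = j + 3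
  have g1 := c_mixed r (j + 2) q
  have g2 := c_mixed r (j + 1) (q + 1)
  rw [show j + 2 + q + 1 = j + q + 3 by ring, show j + 2 + q = j + q + 2 by ring, cA, cN'] at g1
  rw [show j + 1 + (q + 1) + 1 = j + q + 3 by ring, show j + 1 + (q + 1) = j + q + 2 by ring,
    cA, cN'] at g2
  simp only [add_assoc] at g1 g2
  norm_num at g1 g2
  have det : c r (j + 2) * c r (j + 2) - c r (j + 3) * c r (j + 1) = 1 := c_det r (j + 1)
  have p2 := c_pos r hr j
  have p3 := c_pos r hr q
  have lt1 : c r (j + 1) < c r (j + 2) := c_lt r hr (j + 1)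
  have hrec : c r (j + 3) = r * c r (j + 2) - c r (j + 1) := c_rec r (j + 1)
  have hw2' : (w : ℤ) + 2 ≤ r := by exact_mod_cast hw2
  have hP : 0 < c r (j + 3) - (w + 1) * c r (j + 2) := by
    rw [hrec]
    nlinarith [mul_nonneg (show (0 : ℤ) ≤ r - 2 - w by omega) (show 0 ≤ c r (j + 2) by omega)]
  have hlow := lattice N A (c r (j + 3) - (w + 1) * c r (j + 2))
    (c r (j + 2) - (w + 1) * c r (j + 1)) (c r (j + 2)) (c r (j + 1)) (t0 - i)
    (hgt r (j + q + 4) t0 - hgt r (j + q + 4) i) hP (by omega)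
    (by linear_combination -det) (by linarith) (by omega) (by linarith) (by
      have e : (c r (j + 2) - (w + 1) * c r (j + 1)) * N - (c r (j + 3) - (w + 1) * c r (j + 2)) * A
        = (w + 1) * c r (q + 2) - c r (q + 1) := by linear_combination g1 - (w + 1) * g2
      rw [e]
      linarith)
  have hd0 : 0 < c r (j + 3) - w * c r (j + 2) := by linarith
  obtain ⟨D, hD⟩ : ∃ D : ℕ, (D : ℤ) = c r (j + 3) - w * c r (j + 2) :=
    ⟨(c r (j + 3) - w * c r (j + 2)).toNat, Int.toNat_of_nonneg hd0.le⟩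
  have hlow' : (D : ℤ) ≤ t0 - i := by rw [hD]; linarith
  have hDbad : i + D ∈ badSet r (j + q + 4 + 1) i k := by
    rw [hmem]
    refine ⟨by omega, ?_⟩
    obtain ⟨Q, hQ⟩ : ∃ Q : ℤ, Q = c r (j + 2) - w * c r (j + 1) := ⟨_, rfl⟩
    have eL : Q * N - D * A = w * c r (q + 2) - c r (q + 1) := by
      rw [hQ, hD]; linear_combination g1 - w * g2
    have hlt2 : c r (q + 1) < c r (q + 2) := c_lt r hr (q + 1)
    have hw1' : (1 : ℤ) ≤ w := by exact_mod_cast hw1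
    have hLpos : 0 < Q * N - D * A := by
      rw [eL]
      have := mul_le_mul_of_nonneg_right hw1' (show 0 ≤ c r (q + 2) by omega)
      linarith only [this, hlt2]
    have hs2 := (hgt_spec r (j + q + 4) L (i + D)).2
    zify at hs2
    have hN' : (0 : ℤ) < N := by exact_mod_cast hN
    have hQle : Q + hgt r (j + q + 4) i < hgt r (j + q + 4) (i + D) + 1 := by
      refine lt_of_mul_lt_mul_right ?_ hN'.le
      linarith
    have : Q * N ≤ ((hgt r (j + q + 4) (i + D) : ℤ) - hgt r (j + q + 4) i) * N :=
      mul_le_mul_of_nonneg_right (by linarith) hN'.le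
    push_cast
    linarith
  have := hmin _ hDbad
  refine hg ⟨j + 3, w, by omega, by omega, hw1, by omega, t0, ⟨ht0, hmin⟩, ?_⟩
  simp only [show j + 3 - 1 = j + 2 by omega]
  rw [← hD]
  omega

theorem isBG_iff (r n : ℕ) (hr : 2 ≤ r) (hn : 4 ≤ n) (e g : ℕ) (he : 1 ≤ e) (heg : e ≤ g)
    (hg : g ≤ cN r (n - 1)) :
    isBGinterval r n (S r n (e - 1) + 1) (S r n g) ↔ ¬ isVert r n e := by
  have L := lev r hr n hn
  obtain ⟨i, rfl⟩ : ∃ i, e = i + 1 := ⟨e - 1, by omega⟩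
  simp only [Nat.add_sub_cancel]
  have hmono := S_strictMono r n hr
  constructor
  · rintro ⟨a, b, hab, -, hred, heq⟩ hv
    rw [S_eq_vpos r n hr L, S_eq_vpos r n hr L] at heq
    have h1 := hmono (show i < g by omega)
    have h2 := hmono hab
    have hl1 : S r n i + 1 ∈ Finset.Icc (S r n a + 1) (S r n b) := by
      rw [← heq, Finset.mem_Icc]; omega
    have hl2 : S r n a + 1 ∈ Finset.Icc (S r n i + 1) (S r n g) := by
      rw [heq, Finset.mem_Icc]; omega
    rw [Finset.mem_Icc] at hl1 hl2
    have : a = i := hmono.injective (by omega)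
    subst this
    exact hred (red_of_vert r n hr L a b hab hv)
  · intro hv
    refine ⟨i, g, by omega, ?_, not_red_of_not_vert r n hr hn L i g hv, ?_⟩
    · rw [L.cN']; exact_mod_cast hg
    · rw [S_eq_vpos r n hr L, S_eq_vpos r n hr L]

theorem compEnd_spec (V : Finset ℕ) (e : ℕ) (he : e ∈ V) (g : ℕ) :
    Finset.Icc e g ⊆ V ↔ g ≤ compEnd V e := by
  have hbdd : BddAbove {g : ℕ | Finset.Icc e g ⊆ V} := by
    refine ⟨V.sup id, fun g hg => ?_⟩
    rcases le_or_gt e g with h | h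
    · exact Finset.le_sup (f := id) (hg (Finset.mem_Icc.mpr ⟨h, le_rfl⟩))
    · exact h.le.trans (Finset.le_sup (f := id) he)
  have hne : {g : ℕ | Finset.Icc e g ⊆ V}.Nonempty := ⟨e, by simpa using he⟩
  constructor
  · intro h
    exact le_csSup hbdd h
  · intro h
    have : Finset.Icc e (compEnd V e) ⊆ V := Nat.sSup_mem hne hbdd
    exact (Finset.Icc_subset_Icc_right h).trans this

theorem start_exists (V : Finset ℕ) (h0 : 0 ∉ V) (e : ℕ) (he : e ∈ V) :
    ∃ s ∈ starts V, s ≤ e ∧ Finset.Icc s e ⊆ V := by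
  induction e with
  | zero => exact absurd he h0
  | succ e ih =>
    by_cases h : e ∈ V
    · obtain ⟨s, hs, hse, hI⟩ := ih h
      refine ⟨s, hs, by omega, fun y hy => ?_⟩
      rw [Finset.mem_Icc] at hy
      rcases Nat.lt_or_ge e y with h' | h'
      · rwa [show y = e + 1 by omega]
      · exact hI (Finset.mem_Icc.mpr ⟨hy.1, h'⟩)
    · refine ⟨e + 1, ?_, le_rfl, by simpa using he⟩
      unfold starts
      rw [Finset.mem_filter]
      exact ⟨he, h⟩

theorem block_exists (r n e g y : ℕ) (h1 : S r n (e - 1) < y) (h2 : y ≤ S r n g) (he : 1 ≤ e) :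
    ∃ a, e ≤ a ∧ a ≤ g ∧ S r n (a - 1) < y ∧ y ≤ S r n a ∨ g < e - 1 := by
  induction g with
  | zero => rcases Nat.lt_or_ge 0 (e - 1) with h | h
            · exact ⟨0, Or.inr h⟩
            · exfalso
              rw [show e - 1 = 0 by omega] at h1
              omega
  | succ g ih =>
    by_cases h : y ≤ S r n g
    · obtain ⟨a, h' | h'⟩ := ih h
      · exact ⟨a, Or.inl ⟨h'.1, by omega, h'.2.2⟩⟩
      · rcases Nat.lt_or_ge (g + 1) (e - 1) with h3 | h3
        · exact ⟨0, Or.inr h3⟩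
        · exfalso
          rw [show e - 1 = g + 1 by omega] at h1
          omega
    · rcases Nat.lt_or_ge (g + 1) e with h3 | h3
      · rcases Nat.lt_or_ge (g + 1) (e - 1) with h4 | h4
        · exact ⟨0, Or.inr h4⟩
        · exfalso
          rw [show e - 1 = g + 1 by omega] at h1
          omega
      · exact ⟨g + 1, Or.inl ⟨h3, le_rfl, by simpa using h, h2⟩⟩

theorem mem_fmap (r n : ℕ) (hr : 2 ≤ r) (hn : 4 ≤ n) (V : Finset ℕ)
    (hV : V ⊆ Finset.Icc 1 (cN r (n - 1))) (y : ℕ) :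
    y ∈ fmap r n V ↔ (∃ e ∈ V, S r n (e - 1) < y ∧ y ≤ S r n e) ∨
      (∃ e ∈ starts V, isVert r n e ∧ y = S r n (e - 1)) := by
  have hmono := S_strictMono r n hr
  have h0 : 0 ∉ V := fun h => by simpa using hV h
  have hcomp : ∀ e ∈ starts V, e ∈ V ∧ 1 ≤ e ∧ e ≤ compEnd V e ∧
      (y ∈ fcomp r n V e ↔ (S r n (e - 1) < y ∧ y ≤ S r n (compEnd V e)) ∨
        (isVert r n e ∧ y = S r n (e - 1))) := by
    intro e he
    have heV : e ∈ V := (Finset.mem_filter.mp he).1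
    have he1 := (Finset.mem_Icc.mp (hV heV)).1
    have hle : e ≤ compEnd V e := (compEnd_spec V e heV e).1 (by simpa using heV)
    have hgV : compEnd V e ∈ V :=
      (compEnd_spec V e heV _).2 le_rfl (Finset.mem_Icc.mpr ⟨hle, le_rfl⟩)
    have hg := (Finset.mem_Icc.mp (hV hgV)).2
    refine ⟨heV, he1, hle, ?_⟩
    unfold fcomp
    rw [isBG_iff r n hr hn e _ he1 hle hg]
    split_ifs with hv
    · rw [Finset.mem_insert, Finset.mem_Icc]; simp only [hv, true_and, Nat.succ_le_iff]; tauto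
    · rw [Finset.mem_Icc]; simp [hv, Nat.succ_le_iff]
  unfold fmap
  rw [Finset.mem_biUnion]
  constructor
  · rintro ⟨e, he, hy⟩
    obtain ⟨heV, he1, hle, hiff⟩ := hcomp e he
    rcases hiff.1 hy with h | h
    · left
      obtain ⟨a, h' | h'⟩ := block_exists r n e _ y h.1 h.2 he1
      · exact ⟨a, (compEnd_spec V e heV _).2 le_rfl (Finset.mem_Icc.mpr ⟨h'.1, h'.2.1⟩), h'.2.2⟩
      · omega
    · exact Or.inr ⟨e, he, h⟩
  · rintro (⟨a, ha, h1, h2⟩ | ⟨e, he, h⟩)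
    · obtain ⟨s, hs, hsa, hI⟩ := start_exists V h0 a ha
      obtain ⟨hsV, hs1, hle, hiff⟩ := hcomp s hs
      have hag := (compEnd_spec V s hsV a).1 hI
      refine ⟨s, hs, hiff.2 (Or.inl ⟨?_, h2.trans (hmono.monotone hag)⟩)⟩
      exact lt_of_le_of_lt (hmono.monotone (by omega)) h1
    · exact ⟨e, he, (hcomp e he).2.2.2.2 (Or.inr h)⟩

theorem card_fmap_aux (r n : ℕ) (hr : 2 ≤ r) (hn : 4 ≤ n) (V : Finset ℕ)
    (hV : V ⊆ Finset.Icc 1 (cN r (n - 1))) :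
    (fmap r n V).card = ∑ e ∈ V, bseq r n e + ((starts V).filter fun e => isVert r n e).card := by
  have hmono := S_strictMono r n hr
  have h0 : 0 ∉ V := fun h => by simpa using hV h
  have hst : ∀ e ∈ starts V, e ∈ V ∧ 1 ≤ e ∧ e - 1 ∉ V := by
    intro e he
    have h := Finset.mem_filter.mp he
    exact ⟨h.1, (Finset.mem_Icc.mp (hV h.1)).1, h.2⟩
  have uniq : ∀ a b y, 1 ≤ a → 1 ≤ b → S r n (a - 1) < y → y ≤ S r n a →
      S r n (b - 1) < y → y ≤ S r n b → a = b := by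
    intro a b y ha hb h1 h2 h3 h4
    have := hmono.lt_iff_lt.1 (h1.trans_le h4)
    have := hmono.lt_iff_lt.1 (h3.trans_le h2)
    omega
  have hset : fmap r n V = (V.biUnion fun e => Finset.Ioc (S r n (e - 1)) (S r n e)) ∪
      ((starts V).filter fun e => isVert r n e).image fun e => S r n (e - 1) := by
    ext y
    rw [mem_fmap r n hr hn V hV, Finset.mem_union, Finset.mem_biUnion, Finset.mem_image]
    simp only [Finset.mem_Ioc, Finset.mem_filter]
    refine or_congr Iff.rfl ⟨?_, ?_⟩
    · rintro ⟨e, h1, h2, h3⟩; exact ⟨e, ⟨h1, h2⟩, h3.symm⟩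
    · rintro ⟨e, ⟨h1, h2⟩, h3⟩; exact ⟨e, h1, h2, h3.symm⟩
  rw [hset, Finset.card_union_of_disjoint, Finset.card_biUnion, Finset.card_image_of_injOn]
  · congr 1
    refine Finset.sum_congr rfl fun e he => ?_
    have he1 := (Finset.mem_Icc.mp (hV he)).1
    obtain ⟨i, rfl⟩ : ∃ i, e = i + 1 := ⟨e - 1, by omega⟩
    rw [Nat.card_Ioc, S_succ]
    simp
  · intro a ha b hb hab
    have h1 := hst a (Finset.mem_filter.mp ha).1
    have h2 := hst b (Finset.mem_filter.mp hb).1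
    have := hmono.injective hab
    omega
  · intro a ha b hb hab
    rw [Function.onFun, Finset.disjoint_left]
    intro y h1 h2
    rw [Finset.mem_Ioc] at h1 h2
    exact hab (uniq a b y (Finset.mem_Icc.mp (hV ha)).1 (Finset.mem_Icc.mp (hV hb)).1
      h1.1 h1.2 h2.1 h2.2)
  · rw [Finset.disjoint_left]
    intro y h1 h2
    rw [Finset.mem_biUnion] at h1
    rw [Finset.mem_image] at h2
    obtain ⟨a, ha, hy⟩ := h1
    obtain ⟨b, hb, rfl⟩ := h2
    rw [Finset.mem_Ioc] at hy
    have hb' := hst b (Finset.mem_filter.mp hb).1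
    have ha1 := (Finset.mem_Icc.mp (hV ha)).1
    have q1 := hmono.lt_iff_lt.1 hy.1
    have q2 := hmono.le_iff_le.1 hy.2
    exact hb'.2.2 (by rwa [show b - 1 = a by omega])

theorem mem_fstar (r n : ℕ) (hr : 2 ≤ r) (hn : 5 ≤ n) (V : Finset ℕ) (p : ℕ) :
    p ∈ fstar r n V ↔ (1 ≤ p ∧ p ≤ cN r (n - 2)) ∧
      Finset.Icc (S r (n - 1) p + 1 - r) (S r (n - 1) p) ⊆ V := by
  obtain ⟨n, rfl⟩ : ∃ k, n = k + 1 := ⟨n - 1, by omega⟩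
  have hn4 : 4 ≤ n := by omega
  unfold fstar
  simp only [show n + 1 - 1 = n by omega, show n + 1 - 2 = n - 1 by omega]
  simp only [Finset.mem_biUnion, Finset.mem_filter, Finset.mem_powerset, id]
  have hmono := S_strictMono r n hr
  have hstep : ∀ p, 1 ≤ p → S r n p = S r n (p - 1) + (if isVert r n p then r - 1 else r) := by
    intro p hp
    obtain ⟨i, rfl⟩ : ∃ i, p = i + 1 := ⟨p - 1, by omega⟩
    exact S_succ r n i
  constructor
  · rintro ⟨U, ⟨hU, hsub⟩, hp⟩
    have hp1 := Finset.mem_Icc.mp (hU hp)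
    refine ⟨hp1, fun y hy => hsub ?_⟩
    rw [mem_fmap r n hr hn4 U hU]
    rw [Finset.mem_Icc] at hy
    have hs := hstep p hp1.1
    by_cases hlt : S r n (p - 1) < y
    · exact Or.inl ⟨p, hp, hlt, hy.2⟩
    · split_ifs at hs with hv
      · have hyeq : y = S r n (p - 1) := by omega
        by_cases hpU : p - 1 ∈ U
        · left
          have := (Finset.mem_Icc.mp (hU hpU)).1
          exact ⟨p - 1, hpU, by rw [hyeq]; exact hmono (by omega), hyeq.le⟩
        · exact Or.inr ⟨p, Finset.mem_filter.mpr ⟨hp, hpU⟩, hv, hyeq⟩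
      · omega
  · rintro ⟨hp, hsub⟩
    have hU : ({p} : Finset ℕ) ⊆ Finset.Icc 1 (cN r (n - 1)) := by
      simpa using hp
    refine ⟨{p}, ⟨hU, fun y hy => hsub ?_⟩, by simp⟩
    rw [mem_fmap r n hr hn4 _ hU] at hy
    have hs := hstep p hp.1
    rw [Finset.mem_Icc]
    rcases hy with ⟨e, he, h1, h2⟩ | ⟨e, he, hv, h2⟩
    · rw [Finset.mem_singleton] at he
      subst he
      split_ifs at hs <;> omega
    · have := (Finset.mem_filter.mp he).1
      rw [Finset.mem_singleton] at this
      subst this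
      rw [if_pos hv] at hs
      omega

/-- verticals of `D_n` are the `S r (n-1) p`. -/
theorem isVert_iff (r n : ℕ) (hr : 2 ≤ r) (hn : 5 ≤ n) (e : ℕ) (he : 1 ≤ e)
    (he2 : e ≤ cN r (n - 1)) :
    isVert r n e ↔ ∃ p, (1 ≤ p ∧ p ≤ cN r (n - 2)) ∧ S r (n - 1) p = e := by
  have L := lev r hr n (by omega)
  have L' := lev r hr (n - 1) (by omega)
  obtain ⟨i, rfl⟩ : ∃ i, e = i + 1 := ⟨e - 1, by omega⟩
  have hS : ∀ p, S r (n - 1) p = vpos r n p := by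
    intro p
    rw [← S_eq_vpos r (n - 1) hr L', show n - 1 + 1 = n by omega]
  simp only [hS]
  have hA := L.pA
  have hAN := L.AN
  -- `vpos p = i+1` iff `i * A < p * N ≤ (i+1) * A`
  have hv : ∀ p, 1 ≤ p → (vpos r n p = i + 1 ↔
      i * cN r (n - 2) < p * cN r (n - 1) ∧ p * cN r (n - 1) ≤ (i + 1) * cN r (n - 2)) := by
    intro p hp
    unfold vpos
    rw [Nat.div_eq_iff hA]
    generalize cN r (n - 2) = A at *
    generalize cN r (n - 1) = N at *
    have : 1 * 1 ≤ p * N := Nat.mul_le_mul hp (by omega)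
    rw [add_mul]
    constructor <;> intro h <;> omega
  obtain ⟨a1, a2⟩ := hgt_spec r n L i
  obtain ⟨b1, b2⟩ := hgt_spec r n L (i + 1)
  have hs := hgt_succ r n L i
  unfold isVert
  simp only [Nat.add_sub_cancel]
  constructor
  · intro h
    refine ⟨hgt r n (i + 1), ⟨by omega, ?_⟩, (hv _ (by omega)).2 ⟨?_, b1⟩⟩
    · by_contra hc
      push Not at hc
      nlinarith
    · rwa [show hgt r n (i + 1) = hgt r n i + 1 by omega]
  · rintro ⟨p, hp, h⟩
    obtain ⟨h1, h2⟩ := (hv p hp.1).1 h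
    have q1 : hgt r n i < p := lt_of_mul_lt_mul_right (a1.trans_lt h1) (Nat.zero_le _)
    have q2 : p < hgt r n (i + 1) + 1 := lt_of_mul_lt_mul_right (h2.trans_lt b2) (Nat.zero_le _)
    omega

theorem S_le_cN (r n : ℕ) (hr : 2 ≤ r) (hn : 5 ≤ n) (p : ℕ) (hp : p ≤ cN r (n - 2)) :
    S r (n - 1) p ≤ cN r (n - 1) := by
  have L := lev r hr n (by omega)
  have L' := lev r hr (n - 1) (by omega)
  have hA := L.pA
  refine ((S_strictMono r (n - 1) hr).monotone hp).trans ?_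
  rw [← S_eq_vpos r (n - 1) hr L', show n - 1 + 1 = n by omega]
  unfold vpos
  rw [← Nat.lt_succ_iff, Nat.div_lt_iff_lt_mul hA, Nat.succ_mul, mul_comm]
  omega

theorem r_le_S (r n p : ℕ) (hr : 2 ≤ r) (hn : 4 ≤ n) (hp : 1 ≤ p) : r ≤ S r n p := by
  have L := lev r hr n hn
  have h := S_hgt r n hr L 1
  have h1 := (hgt_spec r n L 1).1
  have hAN := L.AN
  have : hgt r n 1 = 0 := by
    by_contra hc
    have : 1 * cN r (n - 1) ≤ hgt r n 1 * cN r (n - 1) :=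
      Nat.mul_le_mul_right _ (by omega)
    omega
  have := (S_strictMono r n hr).monotone hp
  omega

theorem card_fstar (r n : ℕ) (hr : 2 ≤ r) (hn : 5 ≤ n) (V : Finset ℕ)
    (hV : V ⊆ Finset.Icc 1 (cN r (n - 1))) :
    (fstar r n V).card =
      (V.filter fun e => isVert r n e ∧ Finset.Icc (e + 1 - r) e ⊆ V).card := by
  have hmono := S_strictMono r (n - 1) hr
  rw [← Finset.card_image_of_injective (fstar r n V) hmono.injective]
  congr 1
  ext e
  rw [Finset.mem_image, Finset.mem_filter]
  constructor
  · rintro ⟨p, hp, rfl⟩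
    obtain ⟨h1, h2⟩ := (mem_fstar r n hr hn V p).1 hp
    have hm : S r (n - 1) p ∈ V := h2 (Finset.mem_Icc.mpr ⟨by omega, le_rfl⟩)
    have hb := Finset.mem_Icc.mp (hV hm)
    exact ⟨hm, (isVert_iff r n hr hn _ hb.1 hb.2).2 ⟨p, h1, rfl⟩, h2⟩
  · rintro ⟨he, hv, hI⟩
    have hb := Finset.mem_Icc.mp (hV he)
    obtain ⟨p, hp, rfl⟩ := (isVert_iff r n hr hn _ hb.1 hb.2).1 hv
    exact ⟨p, (mem_fstar r n hr hn V p).2 ⟨hp, hI⟩, rfl⟩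

theorem vert_gap (r n : ℕ) (hr : 2 ≤ r) (hn : 5 ≤ n) (a b : ℕ) (ha : 1 ≤ a)
    (hab : a < b) (hb : b ≤ cN r (n - 1)) (hva : isVert r n a) (hvb : isVert r n b) :
    a + (r - 1) ≤ b := by
  obtain ⟨p, hp, rfl⟩ := (isVert_iff r n hr hn _ ha (by omega)).1 hva
  obtain ⟨q, hq, rfl⟩ := (isVert_iff r n hr hn _ (by omega) hb).1 hvb
  have hmono := S_strictMono r (n - 1) hr
  have h1 := hmono.lt_iff_lt.1 hab
  have h2 := hmono.monotone (show p + 1 ≤ q by omega)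
  rw [S_succ] at h2
  have := bseq_pos r (n - 1) hr (p + 1)
  omega

theorem vert_ge (r n : ℕ) (hr : 2 ≤ r) (hn : 5 ≤ n) (a : ℕ) (ha : 1 ≤ a)
    (hb : a ≤ cN r (n - 1)) (hva : isVert r n a) : r ≤ a := by
  obtain ⟨p, hp, rfl⟩ := (isVert_iff r n hr hn _ ha hb).1 hva
  exact r_le_S r (n - 1) p hr (by omega) hp.1

theorem start_unique (V : Finset ℕ) (s t e : ℕ) (hs : s ∈ starts V) (ht : t ∈ starts V)
    (hse : s ≤ e) (hte : t ≤ e) (hS : Finset.Icc s e ⊆ V) (hT : Finset.Icc t e ⊆ V) : s = t := by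
  have hs' := (Finset.mem_filter.mp hs)
  have ht' := (Finset.mem_filter.mp ht)
  rcases lt_trichotomy s t with h | h | h
  · exact absurd (hS (Finset.mem_Icc.mpr ⟨by omega, by omega⟩)) ht'.2
  · exact h
  · exact absurd (hT (Finset.mem_Icc.mpr ⟨by omega, by omega⟩)) hs'.2

theorem delta_eq (r n : ℕ) (hr : 2 ≤ r) (hn : 5 ≤ n) (V : Finset ℕ)
    (hV : V ⊆ Finset.Icc 1 (cN r (n - 1))) :
    deltaV r n V =
      (V.filter fun e => (isVert r n e ∧ e - 1 ∈ V) ∧ ¬ Finset.Icc (e + 1 - r) e ⊆ V).card := by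
  have h0 : 0 ∉ V := fun h => by simpa using hV h
  unfold deltaV deltaComp
  rw [← Finset.card_filter]
  refine Finset.card_bij (fun s hs => s + (Finset.mem_filter.mp hs).2.choose - 1) ?_ ?_ ?_
  · intro s hs
    have hsp := (Finset.mem_filter.mp hs).2.choose_spec
    generalize (Finset.mem_filter.mp hs).2.choose = w at hsp ⊢
    obtain ⟨h1, h2, h3, h4⟩ := hsp
    have hst := (Finset.mem_filter.mp hs).1
    obtain ⟨hsV, hs1⟩ := Finset.mem_filter.mp hst
    have hI := (compEnd_spec V s hsV _).2 h3
    have hs0 := (Finset.mem_Icc.mp (hV hsV)).1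
    rw [Finset.mem_filter]
    refine ⟨hI (Finset.mem_Icc.mpr ⟨by omega, le_rfl⟩), ⟨h4, hI (Finset.mem_Icc.mpr ⟨by omega, by omega⟩)⟩, ?_⟩
    intro hc
    have hm := hI (Finset.mem_Icc.mpr ⟨show s ≤ s + w - 1 by omega, le_rfl⟩)
    have := vert_ge r n hr hn _ (by omega) (Finset.mem_Icc.mp (hV hm)).2 h4
    exact hs1 (hc (Finset.mem_Icc.mpr ⟨by omega, by omega⟩))
  · intro s hs t ht heq
    have hsp := (Finset.mem_filter.mp hs).2.choose_spec
    have htp := (Finset.mem_filter.mp ht).2.choose_spec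
    generalize (Finset.mem_filter.mp hs).2.choose = w at hsp heq
    generalize (Finset.mem_filter.mp ht).2.choose = u at htp heq
    have hst := (Finset.mem_filter.mp hs).1
    have htt := (Finset.mem_filter.mp ht).1
    have hI := (compEnd_spec V s (Finset.mem_filter.mp hst).1 _).2 hsp.2.2.1
    have hJ := (compEnd_spec V t (Finset.mem_filter.mp htt).1 _).2 htp.2.2.1
    rw [← heq] at hJ
    exact start_unique V s t _ hst htt (by omega) (by omega) hI hJ
  · intro e he
    obtain ⟨heV, ⟨hv, he1⟩, hnot⟩ := Finset.mem_filter.mp he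
    obtain ⟨s, hs, hse, hI⟩ := start_exists V h0 e heV
    have hsV := (Finset.mem_filter.mp hs).1
    have hs1 := (Finset.mem_filter.mp hs).2
    have hs0 := (Finset.mem_Icc.mp (hV hsV)).1
    have hne : s ≠ e := by rintro rfl; exact hs1 he1
    have hlt : e + 1 - r < s := by
      by_contra hc
      push Not at hc
      exact hnot ((Finset.Icc_subset_Icc_left hc).trans hI)
    have hce := (compEnd_spec V s hsV e).1 hI
    have hmem : s ∈ (starts V).filter fun e => ∃ w : ℕ, 2 ≤ w ∧ w ≤ r - 1 ∧
        e + w - 1 ≤ compEnd V e ∧ isVert r n (e + w - 1) := by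
      rw [Finset.mem_filter]
      refine ⟨hs, e - s + 1, by omega, by omega, by omega, ?_⟩
      rwa [show s + (e - s + 1) - 1 = e by omega]
    refine ⟨s, hmem, ?_⟩
    have hsp := (Finset.mem_filter.mp hmem).2.choose_spec
    generalize (Finset.mem_filter.mp hmem).2.choose = w at hsp ⊢
    obtain ⟨h1, h2, h3, h4⟩ := hsp
    have hJ := (compEnd_spec V s hsV _).2 h3
    have hm := hV (hJ (Finset.mem_Icc.mpr ⟨show s ≤ s + w - 1 by omega, le_rfl⟩))
    have hm2 := Finset.mem_Icc.mp hm
    have he2 := Finset.mem_Icc.mp (hV heV)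
    rcases lt_trichotomy (s + w - 1) e with h | h | h
    · have := vert_gap r n hr hn _ _ hm2.1 h he2.2 h4 hv
      omega
    · exact h
    · have := vert_gap r n hr hn _ _ he2.1 h hm2.2 hv h4
      omega

theorem card_fmap (r : ℕ) (hr : 2 ≤ r) (n : ℕ) (hn : 5 ≤ n)
    (V : Finset ℕ) (hV : V ⊆ Finset.Icc 1 (cN r (n - 1))) :
    ((fmap r n V).card : ℤ) =
      (r : ℤ) * (V.card : ℤ) - ((fstar r n V).card : ℤ) - (deltaV r n V : ℤ) := by
  rw [card_fmap_aux r n hr (by omega) V hV, card_fstar r n hr hn V hV, delta_eq r n hr hn V hV]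
  have hsum : ∑ e ∈ V, bseq r n e + (V.filter fun e => isVert r n e).card = r * V.card := by
    rw [Finset.card_filter, ← Finset.sum_add_distrib, mul_comm, ← smul_eq_mul,
      ← Finset.sum_const]
    refine Finset.sum_congr rfl fun e _ => ?_
    unfold bseq
    split_ifs <;> omega
  have hsplit : (V.filter fun e => isVert r n e).card =
      ((starts V).filter fun e => isVert r n e).card +
      ((V.filter fun e => isVert r n e ∧ Finset.Icc (e + 1 - r) e ⊆ V).card +
       (V.filter fun e => (isVert r n e ∧ e - 1 ∈ V) ∧
          ¬ Finset.Icc (e + 1 - r) e ⊆ V).card) := by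
    rw [← Finset.card_filter_add_card_filter_not (s := V.filter fun e => isVert r n e)
      (fun e => e - 1 ∉ V)]
    congr 1
    · congr 1
      ext e
      unfold starts
      simp only [Finset.mem_filter]
      tauto
    · rw [← Finset.card_filter_add_card_filter_not
        (s := (V.filter fun e => isVert r n e).filter fun e => ¬ e - 1 ∉ V)
        (fun e => Finset.Icc (e + 1 - r) e ⊆ V)]
      congr 1
      · congr 1
        ext e
        simp only [Finset.mem_filter]
        constructor
        · tauto
        · rintro ⟨h1, h2, h3⟩
          refine ⟨⟨⟨h1, h2⟩, ?_⟩, h3⟩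
          rw [not_not]
          exact h3 (Finset.mem_Icc.mpr ⟨by omega, by omega⟩)
      · congr 1
        ext e
        simp only [Finset.mem_filter]
        tauto
  have h : (r : ℤ) * V.card = ((r * V.card : ℕ) : ℤ) := by push_cast; rfl
  rw [h, ← hsum, hsplit]
  push_cast
  ring

end CF
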